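/- For every integer k ≥ 1 there exists a constant C > 0 (depending only on k) such that for every real N ≥ 2 and every compact convex set D ⊆ [-N,N]^k ⊂ ℝ^k, the absolute value of the integral of g(t_1·t_2·⋯·t_k) over D with respect to Lebesgue measure is at most C·(log N)^{k-1}. -/

import Mathlib

open MeasureTheory Real

/-- `g u = sin u / u`, extended by `g 0 = 1`. -/
noncomputable def g (u : ℝ) : ℝ := if u = 0 then 1 else Real.sin u / u

theorem g_eq_sinc : g = sinc := rfl

theorem abs_integral_sinc_le_abs (a b : ℝ) : |∫ t in a..b, sinc t| ≤ |b - a| := by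
  simpa using intervalIntegral.norm_integral_le_of_norm_le_const (a := a) (b := b)
    (f := sinc) (C := 1) fun x _ => abs_sinc_le_one x

theorem hasDerivAt_integral_sinc_add_cos_div (c : ℝ) {x : ℝ} (hx : 0 < x) :
    HasDerivAt (fun y => (∫ t in (0 : ℝ)..y, sinc t) + cos y / y + c / y)
      (-(cos x + c) / x ^ 2) x := by
  have h1 : HasDerivAt (fun y => ∫ t in (0 : ℝ)..y, sinc t) (sinc x) x :=
    continuous_sinc.integral_hasStrictDerivAt 0 x |>.hasDerivAt
  have h2 := (hasDerivAt_cos x).div (hasDerivAt_id x) hx.ne'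
  have h3 := (hasDerivAt_const x c).div (hasDerivAt_id x) hx.ne'
  convert! (h1.add h2).add h3 using 1
  rw [sinc_of_ne_zero hx.ne']
  simp only [id]
  field_simp
  ring

theorem abs_integral_zero_sinc_le_of_nonneg {x : ℝ} (hx : 0 ≤ x) :
    |∫ t in (0 : ℝ)..x, sinc t| ≤ 3 := by
  rcases le_total x 1 with h | h
  · have := abs_integral_sinc_le_abs 0 x
    rw [sub_zero, abs_of_nonneg hx] at this
    linarith
  have h0 : 0 < x := by linarith
  have hd (c y : ℝ) (hy : y ∈ Set.Ici (1 : ℝ)) :=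
    hasDerivAt_integral_sinc_add_cos_div c (x := y) (by simpa using one_pos.trans_le hy)
  have hcont (c : ℝ) : ContinuousOn
      (fun y => (∫ t in (0 : ℝ)..y, sinc t) + cos y / y + c / y) (Set.Ici 1) :=
    fun y hy => (hd c y hy).continuousAt.continuousWithinAt
  have hanti := antitoneOn_of_hasDerivWithinAt_nonpos (convex_Ici 1) (hcont 1)
    (fun y hy => (hd 1 y (interior_subset hy)).hasDerivWithinAt)
    (fun y _ => div_nonpos_of_nonpos_of_nonneg (by linarith [neg_one_le_cos y]) (sq_nonneg y))
  have hmono := monotoneOn_of_hasDerivWithinAt_nonneg (convex_Ici 1) (hcont (-1))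
    (fun y hy => (hd (-1) y (interior_subset hy)).hasDerivWithinAt)
    (fun y _ => div_nonneg (by linarith [cos_le_one y]) (sq_nonneg y))
  have hl := hmono (Set.mem_Ici.2 le_rfl) (Set.mem_Ici.2 h) h
  have hu := hanti (Set.mem_Ici.2 le_rfl) (Set.mem_Ici.2 h) h
  have h1 := abs_le.1 (abs_integral_sinc_le_abs 0 1)
  have hc1 : cos x / x ≤ 1 / x := by gcongr; exact cos_le_one x
  have hc2 : -1 / x ≤ cos x / x := by gcongr; exact neg_one_le_cos x
  have hneg : -1 / x = -(1 / x) := by ring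
  norm_num at hl hu h1
  rw [abs_le]
  constructor <;> norm_num at * <;> linarith [cos_le_one 1, neg_one_le_cos 1]

theorem abs_integral_zero_sinc_le (x : ℝ) : |∫ t in (0 : ℝ)..x, sinc t| ≤ 3 := by
  rcases le_total 0 x with h | h
  · exact abs_integral_zero_sinc_le_of_nonneg h
  · have := abs_integral_zero_sinc_le_of_nonneg (neg_nonneg.2 h)
    have e := intervalIntegral.integral_comp_neg (a := 0) (b := -x) sinc
    simp only [sinc_neg, neg_neg, neg_zero] at e
    rw [e, intervalIntegral.integral_symm, abs_neg] at this
    exact this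

theorem abs_integral_sinc_le (a b : ℝ) : |∫ t in a..b, sinc t| ≤ 6 := by
  rw [← intervalIntegral.integral_interval_sub_left
    (continuous_sinc.intervalIntegrable 0 b) (continuous_sinc.intervalIntegrable 0 a)]
  have ha := abs_le.1 (abs_integral_zero_sinc_le a)
  have hb := abs_le.1 (abs_integral_zero_sinc_le b)
  rw [abs_le]
  constructor <;> linarith

theorem abs_setIntegral_sinc_mul_le {s : Set ℝ} (hs : IsCompact s) (hc : Convex ℝ s)
    {p : ℝ} (hp : p ≠ 0) : |∫ x in s, sinc (x * p)| ≤ 6 * |p|⁻¹ := by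
  rcases s.eq_empty_or_nonempty with rfl | hne
  · simp
  have hI := eq_Icc_of_connected_compact ⟨hne, hc.isPreconnected⟩ hs
  have hle : sInf s ≤ sSup s := Real.sInf_le_sSup _ hs.bddBelow hs.bddAbove
  rw [hI, integral_Icc_eq_integral_Ioc, ← intervalIntegral.integral_of_le hle,
    intervalIntegral.integral_comp_mul_right _ hp, smul_eq_mul, abs_mul, abs_inv, mul_comm]
  gcongr
  exact abs_integral_sinc_le _ _

theorem abs_setIntegral_sinc_mul_le_length {s : Set ℝ} {N : ℝ} (hN : 0 ≤ N)
    (hs : s ⊆ Set.Icc (-N) N) (p : ℝ) : |∫ x in s, sinc (x * p)| ≤ 2 * N := by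
  have hv : volume s ≤ volume (Set.Icc (-N) N) := measure_mono hs
  have hfin : volume (Set.Icc (-N) N) < ⊤ := isCompact_Icc.measure_lt_top
  have h := norm_setIntegral_le_of_norm_le_const (μ := volume) (s := s)
    (f := fun x => sinc (x * p)) (C := 1) (hv.trans_lt hfin) fun x _ => abs_sinc_le_one _
  have h2 : volume.real s ≤ volume.real (Set.Icc (-N) N) := measureReal_mono hs hfin.ne
  rw [Real.volume_real_Icc_of_le (by linarith)] at h2
  rw [Real.norm_eq_abs] at h
  linarith

/-- The one-variable majorant `2 / (|t| + δ)` on `[-N, N]`, written as a function of `|t|`. -/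
noncomputable def truncatedInv (N δ : ℝ) : ℝ → ℝ :=
  (Set.Iic N).indicator fun r => 2 / (r + δ)

theorem integral_truncatedInv_abs {N δ : ℝ} (hN : 0 ≤ N) (hδ : 0 < δ) :
    ∫ t, truncatedInv N δ |t| = 4 * log ((N + δ) / δ) := by
  have h : ∫ t in (0 : ℝ)..N, 2 / (t + δ) = 2 * log ((N + δ) / δ) := by
    simp_rw [div_eq_mul_inv (2 : ℝ)]
    rw [intervalIntegral.integral_const_mul,
      intervalIntegral.integral_comp_add_right (fun x => x⁻¹), zero_add,
      integral_inv_of_pos hδ (by linarith)]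
  rw [integral_comp_abs, truncatedInv, setIntegral_indicator measurableSet_Iic,
    Set.Ioi_inter_Iic, ← intervalIntegral.integral_of_le hN, h]
  ring

theorem integrable_truncatedInv_abs (N : ℝ) {δ : ℝ} (hδ : 0 < δ) :
    Integrable fun t => truncatedInv N δ |t| := by
  have h : (fun t => truncatedInv N δ |t|) =
      (Set.Icc (-N) N).indicator fun t => 2 / (|t| + δ) := by
    ext t
    simp only [truncatedInv, Set.indicator, Set.mem_Iic, Set.mem_Icc, abs_le]
  rw [h, integrable_indicator_iff measurableSet_Icc]
  refine ContinuousOn.integrableOn_Icc (Continuous.continuousOn ?_)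
  exact continuous_const.div (by fun_prop) fun t => by positivity

theorem truncatedInv_nonneg (N : ℝ) {δ r : ℝ} (hδ : 0 < δ) (hr : 0 ≤ r) :
    0 ≤ truncatedInv N δ r :=
  Set.indicator_apply_nonneg fun _ => by positivity

theorem le_prod_truncatedInv {m : ℕ} {N : ℝ} (hN : 1 ≤ N) {y : Fin m → ℝ}
    (hy : ∀ i, |y i| ≤ N) {i : Fin m} (hi : |y i| ≤ (N ^ (m + 1))⁻¹) :
    N ≤ ∏ j, truncatedInv N (N ^ (m + 1))⁻¹ |y j| := by
  have hN0 : 0 < N := by linarith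
  set δ := (N ^ (m + 1))⁻¹ with hδ
  have hδ0 : 0 < δ := by positivity
  have hδ1 : δ ≤ 1 := inv_le_one_of_one_le₀ (one_le_pow₀ hN)
  have hval (j : Fin m) : truncatedInv N δ |y j| = 2 / (|y j| + δ) :=
    Set.indicator_of_mem (Set.mem_Iic.2 (hy j)) _
  have hother (j : Fin m) : N⁻¹ ≤ truncatedInv N δ |y j| := by
    rw [hval, inv_eq_one_div, div_le_div_iff₀ hN0 (by positivity)]
    linarith [hy j]
  have hsmall : N ^ (m + 1) ≤ truncatedInv N δ |y i| := by
    rw [hval, le_div_iff₀ (by positivity)]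
    have : N ^ (m + 1) * δ = 1 := mul_inv_cancel₀ (by positivity)
    nlinarith [pow_pos hN0 (m + 1)]
  have hcard : (Finset.univ.erase i).card ≤ m := by
    simp
  rw [← Finset.mul_prod_erase _ _ (Finset.mem_univ i)]
  calc N = N ^ (m + 1) * N⁻¹ ^ m := by rw [pow_succ, inv_pow]; field_simp
    _ ≤ N ^ (m + 1) * N⁻¹ ^ (Finset.univ.erase i).card := by
        gcongr 1
        exact pow_le_pow_of_le_one (by positivity) (inv_le_one_of_one_le₀ hN) hcard
    _ ≤ _ := by
        rw [← Finset.prod_const]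
        gcongr with j
        · exact truncatedInv_nonneg N hδ0 (abs_nonneg _)
        · exact hother j

theorem inv_abs_prod_le_prod_truncatedInv {m : ℕ} {N δ : ℝ} (hδ : 0 < δ) {y : Fin m → ℝ}
    (hy : ∀ i, |y i| ≤ N) (hi : ∀ i, δ < |y i|) :
    |∏ i, y i|⁻¹ ≤ ∏ i, truncatedInv N δ |y i| := by
  rw [Finset.abs_prod, ← Finset.prod_inv_distrib]
  refine Finset.prod_le_prod (fun i _ => by positivity) fun i _ => ?_
  have h0 : 0 < |y i| := hδ.trans (hi i)
  rw [truncatedInv, Set.indicator_of_mem (Set.mem_Iic.2 (hy i)), inv_eq_one_div,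
    div_le_div_iff₀ h0 (by positivity)]
  linarith [hi i]

theorem abs_setIntegral_sinc_mul_prod_le {m : ℕ} {N : ℝ} (hN : 1 ≤ N) {y : Fin m → ℝ}
    (hy : ∀ i, |y i| ≤ N) {s : Set ℝ} (hs : IsCompact s) (hc : Convex ℝ s)
    (hsN : s ⊆ Set.Icc (-N) N) :
    |∫ x in s, sinc (x * ∏ i, y i)| ≤ 6 * ∏ i, truncatedInv N (N ^ (m + 1))⁻¹ |y i| := by
  have hδ : 0 < (N ^ (m + 1))⁻¹ := by positivity
  by_cases h : ∃ i, |y i| ≤ (N ^ (m + 1))⁻¹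
  · obtain ⟨i, hi⟩ := h
    have h1 := abs_setIntegral_sinc_mul_le_length (by linarith) hsN (∏ i, y i)
    have h2 := le_prod_truncatedInv hN hy hi
    linarith
  · push Not at h
    have hp : ∏ i, y i ≠ 0 :=
      Finset.prod_ne_zero_iff.2 fun i _ => abs_pos.1 (hδ.trans (h i))
    refine (abs_setIntegral_sinc_mul_le hs hc hp).trans ?_
    gcongr
    exact inv_abs_prod_le_prod_truncatedInv hδ hy h

theorem integral_truncatedInv_abs_le {N : ℝ} (hN : 2 ≤ N) (m : ℕ) :
    ∫ t, truncatedInv N (N ^ (m + 1))⁻¹ |t| ≤ 4 * (m + 3) * log N := by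
  have hN0 : 0 < N := by linarith
  rw [integral_truncatedInv_abs hN0.le (by positivity), mul_assoc]
  gcongr
  have h : (N + (N ^ (m + 1))⁻¹) / (N ^ (m + 1))⁻¹ ≤ N ^ (m + 3) := by
    have h1 : (N + (N ^ (m + 1))⁻¹) / (N ^ (m + 1))⁻¹ = N ^ (m + 2) + 1 := by
      field_simp
      ring
    have h2 : 1 ≤ N ^ (m + 2) := one_le_pow₀ (by linarith)
    rw [h1, pow_succ N (m + 2)]
    nlinarith
  calc log _ ≤ log (N ^ (m + 3)) := log_le_log (by positivity) h
    _ = _ := by rw [log_pow]; push_cast; ring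

theorem setIntegral_eq_integral_setIntegral_cons {m : ℕ} {D : Set (Fin (m + 1) → ℝ)}
    (hD : IsCompact D) {f : (Fin (m + 1) → ℝ) → ℝ} (hf : Continuous f) :
    ∫ t in D, f t = ∫ y : Fin m → ℝ, ∫ x in {x : ℝ | Fin.cons x y ∈ D}, f (Fin.cons x y) := by
  have hmp := (volume_preserving_piFinSuccAbove (fun _ : Fin (m + 1) => ℝ) 0).symm
  have hint : Integrable (D.indicator f) :=
    (integrable_indicator_iff hD.measurableSet).2 (hf.continuousOn.integrableOn_compact hD)
  have he (x : ℝ) (y : Fin m → ℝ) :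
      (MeasurableEquiv.piFinSuccAbove (fun _ : Fin (m + 1) => ℝ) 0).symm (x, y) =
        (Fin.cons x y : Fin (m + 1) → ℝ) := by
    simp [MeasurableEquiv.piFinSuccAbove]
    rfl
  rw [← integral_indicator hD.measurableSet, ← hmp.integral_comp', Measure.volume_eq_prod,
    integral_prod_symm _ ?_]
  · refine integral_congr_ae (.of_forall fun y => ?_)
    have hmeas : MeasurableSet {x : ℝ | (Fin.cons x y : Fin (m + 1) → ℝ) ∈ D} :=
      (hD.isClosed.preimage (by fun_prop : Continuous fun x : ℝ =>
        (Fin.cons x y : Fin (m + 1) → ℝ))).measurableSet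
    simp only [he]
    rw [← integral_indicator hmeas]
    rfl
  · exact (hmp.integrable_comp_emb (MeasurableEquiv.measurableEmbedding _)).2 hint

theorem convex_setOf_cons_mem {m : ℕ} {D : Set (Fin (m + 1) → ℝ)} (hD : Convex ℝ D)
    (y : Fin m → ℝ) : Convex ℝ {x : ℝ | (Fin.cons x y : Fin (m + 1) → ℝ) ∈ D} := by
  intro a ha b hb u v hu hv huv
  have h := hD ha hb hu hv huv
  have e : u • (Fin.cons a y : Fin (m + 1) → ℝ) + v • (Fin.cons b y : Fin (m + 1) → ℝ) =
      Fin.cons (u • a + v • b) y := by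
    ext i
    refine Fin.cases ?_ (fun j => ?_) i
    · simp
    · simp [← add_mul, huv]
  rwa [e] at h

theorem abs_setIntegral_cons_le {m : ℕ} {N : ℝ} (hN : 1 ≤ N) {D : Set (Fin (m + 1) → ℝ)}
    (hD : IsCompact D) (hc : Convex ℝ D)
    (hDN : D ⊆ Set.Icc (fun _ : Fin (m + 1) => -N) (fun _ : Fin (m + 1) => N))
    (y : Fin m → ℝ) :
    |∫ x in {x : ℝ | Fin.cons x y ∈ D}, sinc (∏ i, (Fin.cons x y : Fin (m + 1) → ℝ) i)| ≤
      6 * ∏ i, truncatedInv N (N ^ (m + 1))⁻¹ |y i| := by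
  have hnonneg : 0 ≤ 6 * ∏ i, truncatedInv N (N ^ (m + 1))⁻¹ |y i| :=
    mul_nonneg (by norm_num) <| Finset.prod_nonneg fun i _ =>
      truncatedInv_nonneg N (by positivity) (abs_nonneg _)
  rcases Set.eq_empty_or_nonempty {x : ℝ | (Fin.cons x y : Fin (m + 1) → ℝ) ∈ D} with he | hne
  · simpa [he] using hnonneg
  obtain ⟨x₀, hx₀⟩ := hne
  have hy (i : Fin m) : |y i| ≤ N := by
    have h := hDN hx₀
    exact abs_le.2 ⟨by simpa using h.1 i.succ, by simpa using h.2 i.succ⟩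
  have hsub : {x : ℝ | (Fin.cons x y : Fin (m + 1) → ℝ) ∈ D} ⊆ Set.Icc (-N) N := fun x hx =>
    ⟨by simpa using (hDN hx).1 0, by simpa using (hDN hx).2 0⟩
  have hclosed : IsClosed {x : ℝ | (Fin.cons x y : Fin (m + 1) → ℝ) ∈ D} :=
    hD.isClosed.preimage (by fun_prop : Continuous fun x : ℝ =>
      (Fin.cons x y : Fin (m + 1) → ℝ))
  simp only [Fin.prod_cons]
  exact abs_setIntegral_sinc_mul_prod_le hN hy (isCompact_Icc.of_isClosed_subset hclosed hsub)
    (convex_setOf_cons_mem hc y) hsub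

/-- For every integer `k ≥ 1` there is a constant `C > 0` such that for every `N ≥ 2` and
every compact convex set `D ⊆ [-N, N]^k`, the integral of `g (t₁ ⋯ t_k)` over `D` is at
most `C · (log N)^(k-1)` in absolute value. -/
theorem convex_integral_upper_bound (k : ℕ) (hk : 1 ≤ k) :
    ∃ C : ℝ, 0 < C ∧ ∀ N : ℝ, 2 ≤ N → ∀ D : Set (Fin k → ℝ),
      IsCompact D → Convex ℝ D →
      D ⊆ Set.Icc (fun _ : Fin k => -N) (fun _ : Fin k => N) →
      |∫ t in D, g (∏ i, t i)| ≤ C * (Real.log N) ^ (k - 1) := by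
  obtain ⟨m, rfl⟩ := Nat.exists_eq_succ_of_ne_zero (Nat.one_le_iff_ne_zero.1 hk)
  refine ⟨6 * (4 * (m + 3)) ^ m, by positivity, fun N hN D hD hc hDN => ?_⟩
  have hδ : 0 < (N ^ (m + 1))⁻¹ := by positivity
  have hcont : Continuous fun t : Fin (m + 1) → ℝ => sinc (∏ i, t i) :=
    continuous_sinc.comp (by fun_prop)
  have hint : Integrable fun y : Fin m → ℝ =>
      6 * ∏ i, truncatedInv N (N ^ (m + 1))⁻¹ |y i| :=
    (Integrable.fintype_prod fun _ => integrable_truncatedInv_abs N hδ).const_mul 6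
  rw [g_eq_sinc, setIntegral_eq_integral_setIntegral_cons hD hcont]
  have hbound := norm_integral_le_of_norm_le hint (.of_forall fun y =>
    (Real.norm_eq_abs _).trans_le (abs_setIntegral_cons_le (by linarith) hD hc hDN y))
  refine ((Real.norm_eq_abs _).symm.trans_le hbound).trans ?_
  rw [integral_const_mul,
    integral_fintype_prod_volume_eq_pow fun t => truncatedInv N (N ^ (m + 1))⁻¹ |t|,
    Fintype.card_fin, Nat.succ_sub_one, mul_assoc, ← mul_pow]
  gcongr
  · exact integral_nonneg fun t => truncatedInv_nonneg N hδ (abs_nonneg t)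
  · exact integral_truncatedInv_abs_le hN m
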